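/- arXiv:2504.03121 — 2 statements merged into one kernel-verified Lean document; each statement's English description precedes it below -/
import Mathlib

section
/- If M is a simple G_rT-module, then as a Dist(G_r)^T-module M is isomorphic to the direct sum of its T-weight spaces ⊕_{μ ∈ X} M_μ, and every non-zero weight space M_μ is a simple Dist(G_r)^T-module. -/
section GradedAction

variable {k X A M : Type*} [Field k] [AddCommGroup X] [DecidableEq X] [Ring A] [Algebra k A]
  (𝒜 : X → Submodule k A) [AddCommGroup M] [Module k M] [Module A M]
  (ℳ : X → Submodule k M) [DirectSum.Decomposition ℳ]

/-- The `μ`-component of `a • m` for `m` homogeneous of degree `ν`. -/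
theorem decompose_smul_of_mem_right [GradedAlgebra 𝒜]
    (h : ∀ (μ ν : X), ∀ a ∈ 𝒜 μ, ∀ m ∈ ℳ ν, a • m ∈ ℳ (μ + ν))
    (a : A) {ν : X} {m : M} (hm : m ∈ ℳ ν) (μ : X) :
    (DirectSum.decompose ℳ (a • m) μ : M) = (DirectSum.decompose 𝒜 a (μ - ν) : A) • m := by
  induction a using DirectSum.Decomposition.inductionOn 𝒜 with
  | zero => simp
  | add a b ha hb => simp [add_smul, DirectSum.decompose_add, ha, hb]
  | @homogeneous κ a =>
    have ham := h κ ν a a.2 m hm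
    by_cases e : κ + ν = μ
    · subst e
      rw [DirectSum.decompose_of_mem_same ℳ ham, add_sub_cancel_right,
        DirectSum.decompose_of_mem_same 𝒜 a.2]
    · rw [DirectSum.decompose_of_mem_ne ℳ ham e,
        DirectSum.decompose_of_mem_ne 𝒜 a.2 (fun e' => e (eq_sub_iff_add_eq.mp e')), zero_smul]

/-- The `μ`-component of `a • m` for `a` homogeneous of degree `κ`. -/
theorem decompose_smul_of_mem_left
    (h : ∀ (μ ν : X), ∀ a ∈ 𝒜 μ, ∀ m ∈ ℳ ν, a • m ∈ ℳ (μ + ν))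
    {κ : X} {a : A} (ha : a ∈ 𝒜 κ) (m : M) (μ : X) :
    (DirectSum.decompose ℳ (a • m) μ : M) = a • (DirectSum.decompose ℳ m (μ - κ) : M) := by
  induction m using DirectSum.Decomposition.inductionOn ℳ with
  | zero => simp
  | add m n hm hn => simp [smul_add, DirectSum.decompose_add, hm, hn]
  | @homogeneous ν m =>
    have ham := h κ ν a ha m m.2
    by_cases e : κ + ν = μ
    · subst e
      rw [DirectSum.decompose_of_mem_same ℳ ham, add_sub_cancel_left,
        DirectSum.decompose_of_mem_same ℳ m.2]
    · rw [DirectSum.decompose_of_mem_ne ℳ ham e,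
        DirectSum.decompose_of_mem_ne ℳ m.2 (fun e' => e (eq_sub_iff_add_eq'.mp e')), smul_zero]

/-- The largest `A`-stable subspace of `M` whose `μ`-components all lie in `N`. -/
def coinducedSubmodule [IsScalarTower k A M] (μ : X) (N : Submodule k M) : Submodule k M where
  carrier := {m | ∀ a : A, (DirectSum.decompose ℳ (a • m) μ : M) ∈ N}
  zero_mem' a := by simp
  add_mem' hm hn a := by
    simpa [smul_add, DirectSum.decompose_add] using N.add_mem (hm a) (hn a)
  smul_mem' c m hm a := by
    have := SMulCommClass.symm k A M
    rw [smul_comm, DirectSum.decompose_smul]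
    exact N.smul_mem c (hm a)

end GradedAction

/-!
STATEMENT 12: If `M` is a simple `G_rT`-module, then as a `Dist(G_r)^T`-module `M` is
isomorphic to the direct sum of its `T`-weight spaces `⊕_{μ ∈ X} M_μ`, and every non-zero
weight space `M_μ` is a simple `Dist(G_r)^T`-module.

Here `A` plays the role of `Dist(G_r)` with adjoint `T`-weight decomposition `𝒜`
(so `Dist(G_r)^T = 𝒜 0`), indexed by the character group `X` of `T`.  A `G_rT`-module is
an `A`-module with a compatible `T`-weight space decomposition `ℳ` (hypothesis `hGrT`);
it is simple when it is non-zero and has no non-trivial `A`-stable `T`-stable (i.e. graded)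
subspace (hypotheses `hM` and `hsimple`).
-/
theorem statement12
    -- the base field: algebraically closed, characteristic p > 0
    (k : Type) [Field k] [IsAlgClosed k] (p : ℕ) [Fact p.Prime] [CharP k p] (r : ℕ) (hr : 1 ≤ r)
    -- the character group of T
    (X : Type) [AddCommGroup X] [DecidableEq X]
    -- A = Dist(G_r), with its adjoint T-weight decomposition
    (A : Type) [Ring A] [Algebra k A]
    (𝒜 : X → Submodule k A) [GradedAlgebra 𝒜]
    -- M, a G_rT-module
    (M : Type) [AddCommGroup M] [Module k M] [Module A M] [IsScalarTower k A M]
    (ℳ : X → Submodule k M) [DirectSum.Decomposition ℳ]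
    (hGrT : ∀ (μ ν : X), ∀ a ∈ 𝒜 μ, ∀ m ∈ ℳ ν, a • m ∈ ℳ (μ + ν))
    -- M is a simple G_rT-module
    (hM : Nontrivial M)
    (hsimple : ∀ N : Submodule k M, (∀ a : A, ∀ m ∈ N, a • m ∈ N) →
      (∀ μ : X, ∀ m ∈ N, ((DirectSum.decompose ℳ m μ : ↥(ℳ μ)) : M) ∈ N) →
      N = ⊥ ∨ N = ⊤) :
    -- each weight space is a Dist(G_r)^T-submodule and M is, over Dist(G_r)^T,
    -- the direct sum of its weight spaces ...
    (∀ μ : X, ∀ a ∈ 𝒜 0, ∀ m ∈ ℳ μ, a • m ∈ ℳ μ) ∧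
    DirectSum.IsInternal ℳ ∧
    -- ... and every non-zero weight space M_μ is a simple Dist(G_r)^T-module
    (∀ μ : X, ℳ μ ≠ ⊥ →
      ∀ N : Submodule k M, N ≤ ℳ μ → (∀ a ∈ 𝒜 0, ∀ m ∈ N, a • m ∈ N) →
        N = ⊥ ∨ N = ℳ μ) := by
  have hzero : ∀ μ : X, ∀ a ∈ 𝒜 0, ∀ m ∈ ℳ μ, a • m ∈ ℳ μ := fun μ a ha m hm => by
    simpa using hGrT 0 μ a ha m hm
  refine ⟨hzero, DirectSum.Decomposition.isInternal ℳ, fun μ _ N hN hstable => ?_⟩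
  rcases hsimple (coinducedSubmodule (A := A) ℳ μ N)
    (fun a m hm b => by simpa [mul_smul] using hm (b * a))
    (fun ν m hm a => by
      rw [decompose_smul_of_mem_right 𝒜 ℳ hGrT a (SetLike.coe_mem _) μ]
      have := hm (DirectSum.decompose 𝒜 a (μ - ν) : A)
      rwa [decompose_smul_of_mem_left 𝒜 ℳ hGrT (SetLike.coe_mem _), sub_sub_cancel] at this)
    with hbot | htop
  · left
    rw [eq_bot_iff, ← hbot]
    intro n hn a
    rw [decompose_smul_of_mem_right 𝒜 ℳ hGrT a (hN hn) μ, sub_self]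
    exact hstable _ (SetLike.coe_mem _) n hn
  · right
    refine le_antisymm hN fun m hm => ?_
    have hmem : m ∈ coinducedSubmodule (A := A) ℳ μ N := htop ▸ Submodule.mem_top
    simpa [DirectSum.decompose_of_mem_same ℳ hm] using hmem 1
end

section
/- Let A be a finite-dimensional algebra over an algebraically closed field k and B a k-subalgebra of A. If {S_i}_{i∈I} is a complete set of pairwise non-isomorphic simple B-modules and {T_j}_{j∈J} a complete set of pairwise non-isomorphic simple A-modules, then Σ_{i∈I} dim_k S_i ≤ Σ_{j∈J} dim_k T_j. -/
open Polynomial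

namespace IsSimpleModule

variable (k : Type*) {R : Type*} [Field k] [Ring R] [Algebra k R]

theorem finiteDimensional [FiniteDimensional k R] (M : Type*) [AddCommGroup M] [Module k M]
    [Module R M] [IsScalarTower k R M] [IsSimpleModule R M] : FiniteDimensional k M := by
  have := IsSimpleModule.nontrivial R M
  obtain ⟨m, hm⟩ := exists_ne (0 : M)
  exact Module.Finite.of_surjective ((LinearMap.toSpanSingleton R M m).restrictScalars k)
    (IsSimpleModule.toSpanSingleton_surjective R hm)

/-- **Schur's lemma** over an algebraically closed field. -/
theorem exists_forall_eq_smul [IsAlgClosed k] {M : Type*} [AddCommGroup M] [Module k M]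
    [Module R M] [IsScalarTower k R M] [IsSimpleModule R M] [FiniteDimensional k M]
    (f : M →ₗ[R] M) : ∃ c : k, ∀ x, f x = c • x := by
  have := IsSimpleModule.nontrivial R M
  obtain ⟨c, hc⟩ := Module.End.exists_eigenvalue (f.restrictScalars k : Module.End k M)
  obtain ⟨v, hv⟩ := hc.exists_hasEigenvector
  refine ⟨c, fun x ↦ ?_⟩
  have hzero : f - c • LinearMap.id = 0 := by
    refine (LinearMap.bijective_or_eq_zero (f - c • LinearMap.id)).resolve_left fun h ↦ hv.2 ?_
    apply h.1
    simpa [sub_eq_zero] using hv.apply_eq_smul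
  simpa [sub_eq_zero] using LinearMap.congr_fun hzero x

/-- **Burnside's theorem**: a finite-dimensional algebra over an algebraically closed field
surjects onto the product of the endomorphism algebras of finitely many pairwise non-isomorphic
simple modules. -/
theorem exists_forall_smul_eq [IsAlgClosed k] [FiniteDimensional k R] {ι : Type*} [Fintype ι]
    (S : ι → Type*) [∀ i, AddCommGroup (S i)] [∀ i, Module k (S i)] [∀ i, Module R (S i)]
    [∀ i, IsScalarTower k R (S i)] [∀ i, IsSimpleModule R (S i)]
    (hS : Pairwise fun i j ↦ IsEmpty (S i ≃ₗ[R] S j)) (D : ∀ i, Module.End k (S i)) :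
    ∃ r : R, ∀ i x, r • x = D i x := by
  classical
  have hfin (i) : FiniteDimensional k (S i) := finiteDimensional k (R := R) (S i)
  have hEnd (g : Module.End R (∀ i, S i)) (i) : ∃ c : k, ∀ m, g m i = c • m i := by
    obtain ⟨c, hc⟩ := exists_forall_eq_smul k
      (LinearMap.proj i ∘ₗ g ∘ₗ LinearMap.single R S i)
    refine ⟨c, fun m ↦ ?_⟩
    rw [← hc]
    conv_lhs => rw [← Finset.univ_sum_single m, map_sum, Finset.sum_apply]
    refine Finset.sum_eq_single i (fun j _ hj ↦ ?_) (by simp)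
    have hzero := (LinearMap.bijective_or_eq_zero
      (LinearMap.proj i ∘ₗ g ∘ₗ LinearMap.single R S j)).resolve_left
        fun h ↦ (hS hj).false (LinearEquiv.ofBijective _ h)
    exact LinearMap.congr_fun hzero (m j)
  let F : Module.End (Module.End R (∀ i, S i)) (∀ i, S i) :=
    { toFun := fun m i ↦ D i (m i)
      map_add' := fun _ _ ↦ by ext; simp
      map_smul' := fun g m ↦ by
        ext i
        obtain ⟨c, hc⟩ := hEnd g i
        simp [hc] }
  let b (i) := Module.finBasis k (S i)
  obtain ⟨r, hr⟩ := jacobson_density F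
    (Finset.univ.image fun p : Σ i, Fin (Module.finrank k (S i)) ↦ Pi.single p.1 (b p.1 p.2))
  refine ⟨r, fun i x ↦ ?_⟩
  have heq : Module.toModuleEnd k (S i) r = D i := (b i).ext fun a ↦ by
    have := congrFun (hr _ (Finset.mem_image_of_mem _ (Finset.mem_univ ⟨i, a⟩))) i
    simpa [F] using this.symm
  exact LinearMap.congr_fun heq x

/-- There is an element acting on finitely many pairwise non-isomorphic simple modules with as
many distinct eigenvalues as the sum of their dimensions. -/
theorem exists_injective_eigenvalues [IsAlgClosed k] [FiniteDimensional k R] {ι : Type*}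
    [Fintype ι] (S : ι → Type*) [∀ i, AddCommGroup (S i)] [∀ i, Module k (S i)]
    [∀ i, Module R (S i)] [∀ i, IsScalarTower k R (S i)] [∀ i, IsSimpleModule R (S i)]
    (hS : Pairwise fun i j ↦ IsEmpty (S i ≃ₗ[R] S j)) :
    ∃ (r : R) (μ : (Σ i, Fin (Module.finrank k (S i))) → k), Function.Injective μ ∧
      ∀ p, ∃ v : S p.1, v ≠ 0 ∧ r • v = μ p • v := by
  have hfin (i) : FiniteDimensional k (S i) := finiteDimensional k (R := R) (S i)
  let b (i) := Module.finBasis k (S i)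
  let μ : (Σ i, Fin (Module.finrank k (S i))) ↪ k :=
    (Fintype.equivFin _).toEmbedding.trans (Fin.valEmbedding.trans (Infinite.natEmbedding k))
  obtain ⟨r, hr⟩ := exists_forall_smul_eq k S hS
    fun i ↦ (b i).constr k fun a ↦ μ ⟨i, a⟩ • b i a
  exact ⟨r, μ, μ.injective, fun p ↦ ⟨b p.1 p.2, (b p.1).ne_zero p.2, by simp [hr]⟩⟩

end IsSimpleModule

theorem isNilpotent_of_forall_isMaximal {R : Type*} [Ring R] [IsArtinianRing R] {a : R}
    (ha : ∀ m : Ideal R, m.IsMaximal → a ∈ m) : IsNilpotent a := by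
  have hmem : a ∈ Ring.jacobson R := by
    rw [Ring.jacobson_eq_sInf_isMaximal]
    exact Submodule.mem_sInf.mpr ha
  obtain ⟨n, hn⟩ := IsSemiprimaryRing.isNilpotent (R := R)
  exact ⟨n, by simpa [hn] using Ideal.pow_mem_pow hmem n⟩

theorem Polynomial.aeval_smul_of_smul_eq {k R M : Type*} [Field k] [Ring R] [Algebra k R]
    [AddCommGroup M] [Module k M] [Module R M] [IsScalarTower k R M] {r : R} {c : k} {v : M}
    (h : r • v = c • v) (p : k[X]) : aeval r p • v = p.eval c • v := by
  have := Module.End.aeval_apply_of_mem_apply_eq_smul (f := Algebra.lsmul k k M r) (p := p) h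
  rwa [aeval_algHom_apply] at this

/-!
STATEMENT 15: Let `A` be a finite-dimensional algebra over an algebraically closed field `k`
and `B` a `k`-subalgebra of `A`.  If `{S i}_{i ∈ I}` is a complete set of pairwise
non-isomorphic simple `B`-modules and `{T j}_{j ∈ J}` a complete set of pairwise
non-isomorphic simple `A`-modules, then `Σ_{i ∈ I} dim_k S i ≤ Σ_{j ∈ J} dim_k T j`.
-/
theorem statement15
    (k : Type) [Field k] [IsAlgClosed k]
    (A : Type) [Ring A] [Algebra k A] [FiniteDimensional k A]
    (B : Subalgebra k A)
    (I J : Type) [Fintype I] [Fintype J]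
    -- a complete set of pairwise non-isomorphic simple B-modules
    (S : I → Type) [∀ i, AddCommGroup (S i)] [∀ i, Module k (S i)]
    [∀ i, Module B (S i)] [∀ i, IsScalarTower k B (S i)]
    (hSsimple : ∀ i, IsSimpleModule B (S i))
    (hSdistinct : ∀ i i', i ≠ i' → IsEmpty (S i ≃ₗ[B] S i'))
    (hScomplete : ∀ (M : Type) [AddCommGroup M] [Module B M],
      IsSimpleModule B M → ∃ i, Nonempty (M ≃ₗ[B] S i))
    -- a complete set of pairwise non-isomorphic simple A-modules
    (T : J → Type) [∀ j, AddCommGroup (T j)] [∀ j, Module k (T j)]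
    [∀ j, Module A (T j)] [∀ j, IsScalarTower k A (T j)]
    (hTsimple : ∀ j, IsSimpleModule A (T j))
    (hTdistinct : ∀ j j', j ≠ j' → IsEmpty (T j ≃ₗ[A] T j'))
    (hTcomplete : ∀ (M : Type) [AddCommGroup M] [Module A M],
      IsSimpleModule A M → ∃ j, Nonempty (M ≃ₗ[A] T j)) :
    ∑ i, Module.finrank k (S i) ≤ ∑ j, Module.finrank k (T j) := by
  have hTfin (j) : FiniteDimensional k (T j) :=
    IsSimpleModule.finiteDimensional k (R := A) (T j)
  obtain ⟨b, μ, hμ, hv⟩ := IsSimpleModule.exists_injective_eigenvalues k S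
    fun i i' ↦ hSdistinct i i'
  let φ (j) : A →ₐ[k] Module.End k (T j) := Algebra.lsmul k k (T j)
  let p : k[X] := ∏ j, (φ j b).charpoly
  have hp : p.Monic := monic_prod_of_monic _ _ fun j _ ↦ LinearMap.charpoly_monic _
  have hdeg : p.natDegree = ∑ j, Module.finrank k (T j) := by
    rw [natDegree_prod_of_monic _ _ fun j _ ↦ LinearMap.charpoly_monic _]
    exact Finset.sum_congr rfl fun j _ ↦ LinearMap.charpoly_natDegree _
  have hkill (j) (x : T j) : aeval (b : A) p • x = 0 := by
    have hzero : φ j (aeval (b : A) p) = 0 := by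
      rw [← aeval_algHom_apply]
      exact aeval_eq_zero_of_dvd_aeval_eq_zero
        (Finset.dvd_prod_of_mem _ (Finset.mem_univ j)) (LinearMap.aeval_self_charpoly _)
    exact LinearMap.congr_fun hzero x
  have := IsArtinianRing.of_finite k A
  obtain ⟨n, hn⟩ : IsNilpotent (aeval (b : A) p) := by
    refine isNilpotent_of_forall_isMaximal fun m hm ↦ ?_
    obtain ⟨j, ⟨e⟩⟩ := hTcomplete (A ⧸ m) (isSimpleModule_iff_isCoatom.mpr hm.out)
    rw [← Submodule.Quotient.mk_eq_zero m, ← e.map_eq_zero_iff, ← mul_one (aeval (b : A) p),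
      ← smul_eq_mul, Submodule.Quotient.mk_smul, map_smul, hkill]
  have hnB : aeval b (p ^ n) = 0 := by
    apply Subtype.val_injective
    simpa [← hn] using (aeval_algHom_apply B.val b (p ^ n)).symm
  have hroot (q) : p.IsRoot (μ q) := by
    obtain ⟨v, hv0, hv⟩ := hv q
    have := aeval_smul_of_smul_eq hv (p ^ n)
    rw [hnB, zero_smul, eq_comm, smul_eq_zero, or_iff_left hv0, eval_pow] at this
    exact eq_zero_of_pow_eq_zero this
  calc ∑ i, Module.finrank k (S i) = (Finset.univ.map ⟨μ, hμ⟩).card := by simp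
    _ ≤ p.natDegree := card_le_degree_of_subset_roots fun x hx ↦ by
        obtain ⟨q, -, rfl⟩ := Finset.mem_map.mp hx
        exact (mem_roots hp.ne_zero).mpr (hroot q)
    _ = _ := hdeg
end
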